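/- arXiv:1405.2878 — 2 statements merged into one kernel-verified Lean document; each statement's English description precedes it below -/
import Mathlib

section
/- Let (π_i)_{i≥0} be a CPI sequence with steps α_i ∈ (0,1], suppose d_{π_{i−1},ν} e_i ≤ ε for all i ≥ 1 where ε ∈ (0, 2Vmax], and assume C^{(1,0)} := (1−γ)Σ_{l≥0}γ^l c(l) < ∞. Then: (a) for every k with Σ_{i=1}^{k} α_i ≥ log(2Vmax/ε)/(1−γ), one has μ(v_{π*} − v_{π_k}) ≤ (C^{(1,0)}(Σ_{i=1}^{k}α_i)/(1−γ)^2 + 1) ε; (b) if moreover α_i ≥ (1−γ)ε/(12γVmax) for all i, then the smallest such k, call it k†, satisfies k† ≤ (12γVmax/((1−γ)ε)) (log(2Vmax/ε)/(1−γ) + 1), and μ(v_{π*} − v_{π_{k†}}) ≤ (C^{(1,0)}(log(2Vmax/ε)/(1−γ) + 1)/(1−γ)^2 + 1) ε. -/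
open Finset Matrix

noncomputable section

/-- Transition matrix of a deterministic stationary policy. -/
def polMat {S A : Type*} (P : S → A → S → ℝ) (π : S → A) : Matrix S S ℝ :=
  Matrix.of fun s s' => P s (π s) s'

/-- Bellman operator `T_π v = r + γ P_π v` of a deterministic stationary policy. -/
def bOp {S A : Type*} [Fintype S] (P : S → A → S → ℝ) (γ : ℝ) (r : S → ℝ)
    (π : S → A) (v : S → ℝ) : S → ℝ :=
  fun s => r s + γ * ∑ s' : S, P s (π s) s' * v s'

/-- `errOf P γ r v π = max_{π'} T_{π'} v − T_π v` (componentwise maximum over all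
deterministic stationary policies `π'`). -/
def errOf {S A : Type*} [Fintype S] [Fintype A] [DecidableEq S] [Nonempty A]
    (P : S → A → S → ℝ) (γ : ℝ) (r : S → ℝ) (v : S → ℝ) (π : S → A) : S → ℝ :=
  fun s => (Finset.univ.sup' Finset.univ_nonempty fun π' : S → A => bOp P γ r π' v s)
    - bOp P γ r π v s

/-- Values of the PSDP∞ non-stationary policies: `vSig P γ r πseq k = v_{σ_k}
= T_{π_k} T_{π_{k-1}} ⋯ T_{π_1} r` (so `vSig P γ r πseq 0 = r`). -/
def vSig {S A : Type*} [Fintype S] (P : S → A → S → ℝ) (γ : ℝ) (r : S → ℝ)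
    (πseq : ℕ → S → A) : ℕ → S → ℝ
  | 0 => r
  | k+1 => bOp P γ r (πseq (k+1)) (vSig P γ r πseq k)


/-- Transition matrix of a stochastic stationary policy:
`P_π(s,s') = Σ_a π(a|s) P(s'|s,a)`. -/
def polMatS {S A : Type*} [Fintype A] (P : S → A → S → ℝ) (π : S → A → ℝ) :
    Matrix S S ℝ :=
  Matrix.of fun s s' => ∑ a : A, π s a * P s a s'

/-- Bellman operator of a stochastic stationary policy. -/
def bOpS {S A : Type*} [Fintype S] [Fintype A] (P : S → A → S → ℝ) (γ : ℝ) (r : S → ℝ)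
    (π : S → A → ℝ) (v : S → ℝ) : S → ℝ :=
  fun s => r s + γ * ∑ s' : S, (∑ a : A, π s a * P s a s') * v s'

/-- A deterministic policy viewed as a stochastic one. -/
def detPol {S A : Type*} [DecidableEq A] (π : S → A) : S → A → ℝ :=
  fun s a => if a = π s then 1 else 0

/-- Per-state mixture `(1−α)π + απ'` of two stochastic policies. -/
def mixPol {S A : Type*} (α : ℝ) (π π' : S → A → ℝ) : S → A → ℝ :=
  fun s a => (1 - α) * π s a + α * π' s a

/-- `π` is a stochastic stationary policy. -/
def isStoch {S A : Type*} [Fintype A] (π : S → A → ℝ) : Prop :=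
  (∀ s a, 0 ≤ π s a) ∧ ∀ s, ∑ a : A, π s a = 1

/-- The CPI sequence `π_0`, `π_i = (1−α_i)π_{i−1} + α_i π'_i`. -/
def cpiSeq {S A : Type*} [DecidableEq A] (π0 : S → A → ℝ) (αf : ℕ → ℝ)
    (π'f : ℕ → S → A) : ℕ → S → A → ℝ
  | 0 => π0
  | i+1 => mixPol (αf (i+1)) (cpiSeq π0 αf π'f i) (detPol (π'f (i+1)))

section Discounted

variable {S : Type*} [Fintype S] [DecidableEq S]

omit [DecidableEq S] in
lemma mulVec_le_mulVec_of_nonneg {M : Matrix S S ℝ} (hM : ∀ i j, 0 ≤ M i j) {x y : S → ℝ}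
    (hxy : ∀ s, x s ≤ y s) (s : S) : (M *ᵥ x) s ≤ (M *ᵥ y) s :=
  Finset.sum_le_sum fun j _ => mul_le_mul_of_nonneg_left (hxy j) (hM s j)

omit [DecidableEq S] in
lemma mulVec_nonneg_of_nonneg {M : Matrix S S ℝ} (hM : ∀ i j, 0 ≤ M i j) {x : S → ℝ}
    (hx : ∀ s, 0 ≤ x s) (s : S) : 0 ≤ (M *ᵥ x) s :=
  Finset.sum_nonneg fun j _ => mul_nonneg (hM s j) (hx j)

lemma mulVec_const_of_mem_rowStochastic {M : Matrix S S ℝ} (hM : M ∈ rowStochastic ℝ S)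
    (b : ℝ) (s : S) : (M *ᵥ fun _ => b) s = b := by
  have h := sum_row_of_mem_rowStochastic hM s
  simp only [mulVec, dotProduct, ← Finset.sum_mul, h, one_mul]

lemma nonneg_of_discounted_mulVec_le {M : Matrix S S ℝ} (hM : M ∈ rowStochastic ℝ S) {γ : ℝ}
    (hγ0 : 0 ≤ γ) (hγ1 : γ < 1) {x : S → ℝ} (hx : ∀ s, γ * (M *ᵥ x) s ≤ x s) (s : S) :
    0 ≤ x s := by
  have : Nonempty S := ⟨s⟩
  obtain ⟨t, ht⟩ := Finite.exists_min x
  have h1 : x t ≤ (M *ᵥ x) t := by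
    calc x t = (M *ᵥ fun _ => x t) t := (mulVec_const_of_mem_rowStochastic hM _ t).symm
      _ ≤ _ := mulVec_le_mulVec_of_nonneg hM.1 ht t
  have h2 := hx t
  have h3 := ht s
  nlinarith [mul_le_mul_of_nonneg_left h1 hγ0]

lemma isUnit_one_sub_smul_of_mem_rowStochastic {M : Matrix S S ℝ}
    (hM : M ∈ rowStochastic ℝ S) {γ : ℝ} (hγ0 : 0 ≤ γ) (hγ1 : γ < 1) :
    IsUnit (1 - γ • M) := by
  rw [← mulVec_injective_iff_isUnit]
  have key : ∀ x y : S → ℝ, (1 - γ • M) *ᵥ x = (1 - γ • M) *ᵥ y → ∀ s, x s ≤ y s := by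
    intro x y h s
    have := nonneg_of_discounted_mulVec_le hM hγ0 hγ1 (x := y - x) (fun s => by
      have := congrFun h s
      simp only [sub_mulVec, one_mulVec, smul_mulVec, Pi.sub_apply, Pi.smul_apply,
        smul_eq_mul] at this
      simp only [mulVec_sub, Pi.sub_apply]
      linarith) s
    simpa using this
  intro x y h
  funext s
  exact le_antisymm (key x y h s) (key y x h.symm s)

lemma resolvent_mulVec {M : Matrix S S ℝ} (hM : M ∈ rowStochastic ℝ S) {γ : ℝ}
    (hγ0 : 0 ≤ γ) (hγ1 : γ < 1) (x : S → ℝ) :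
    (1 - γ • M)⁻¹ *ᵥ x = x + γ • (M *ᵥ ((1 - γ • M)⁻¹ *ᵥ x)) := by
  have hu := (isUnit_iff_isUnit_det _).1 (isUnit_one_sub_smul_of_mem_rowStochastic hM hγ0 hγ1)
  have h : (1 - γ • M) *ᵥ ((1 - γ • M)⁻¹ *ᵥ x) = x := by
    rw [mulVec_mulVec, mul_nonsing_inv _ hu, one_mulVec]
  rw [sub_mulVec, one_mulVec, smul_mulVec] at h
  exact sub_eq_iff_eq_add.1 h

lemma resolvent_mulVec_nonneg {M : Matrix S S ℝ} (hM : M ∈ rowStochastic ℝ S) {γ : ℝ}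
    (hγ0 : 0 ≤ γ) (hγ1 : γ < 1) {x : S → ℝ} (hx : ∀ s, 0 ≤ x s) (s : S) :
    0 ≤ ((1 - γ • M)⁻¹ *ᵥ x) s := by
  refine nonneg_of_discounted_mulVec_le hM hγ0 hγ1 (fun s => ?_) s
  have := congrFun (resolvent_mulVec hM hγ0 hγ1 x) s
  simp only [Pi.add_apply, Pi.smul_apply, smul_eq_mul] at this
  linarith [hx s]

lemma le_resolvent_mulVec {M : Matrix S S ℝ} (hM : M ∈ rowStochastic ℝ S) {γ : ℝ}
    (hγ0 : 0 ≤ γ) (hγ1 : γ < 1) {x : S → ℝ} (hx : ∀ s, 0 ≤ x s) (s : S) :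
    x s ≤ ((1 - γ • M)⁻¹ *ᵥ x) s := by
  have h := congrFun (resolvent_mulVec hM hγ0 hγ1 x) s
  simp only [Pi.add_apply, Pi.smul_apply, smul_eq_mul] at h
  have := mulVec_nonneg_of_nonneg hM.1 (resolvent_mulVec_nonneg hM hγ0 hγ1 hx) s
  nlinarith [mul_nonneg hγ0 this]

lemma abs_le_of_discounted_fixed_point {M : Matrix S S ℝ} (hM : M ∈ rowStochastic ℝ S)
    {γ : ℝ} (hγ0 : 0 ≤ γ) (hγ1 : γ < 1) {r v : S → ℝ} {b : ℝ}
    (hr : ∀ s, |r s| ≤ (1 - γ) * b) (hv : ∀ s, v s = r s + γ * (M *ᵥ v) s) (s : S) :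
    |v s| ≤ b := by
  have h1 := nonneg_of_discounted_mulVec_le hM hγ0 hγ1 (x := (fun _ => b) - v) (fun s => by
    rw [mulVec_sub, Pi.sub_apply, mulVec_const_of_mem_rowStochastic hM, Pi.sub_apply]
    linarith [hv s, (abs_le.1 (hr s)).2]) s
  have h2 := nonneg_of_discounted_mulVec_le hM hγ0 hγ1 (x := (fun _ => b) + v) (fun s => by
    rw [mulVec_add, Pi.add_apply, mulVec_const_of_mem_rowStochastic hM, Pi.add_apply]
    linarith [hv s, (abs_le.1 (hr s)).1]) s
  rw [Pi.sub_apply] at h1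
  rw [Pi.add_apply] at h2
  exact abs_le.2 ⟨by linarith, by linarith⟩

end Discounted

section Policies

variable {S A : Type*} [Fintype S] [Fintype A] [DecidableEq S]
  {P : S → A → S → ℝ}

omit [Fintype A] in
lemma polMat_mem_rowStochastic (hP0 : ∀ s a s', 0 ≤ P s a s')
    (hP1 : ∀ s a, ∑ s' : S, P s a s' = 1) (π : S → A) :
    polMat P π ∈ rowStochastic ℝ S :=
  mem_rowStochastic_iff_sum.2 ⟨fun s s' => hP0 s (π s) s', fun s => hP1 s (π s)⟩

lemma polMatS_mem_rowStochastic (hP0 : ∀ s a s', 0 ≤ P s a s')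
    (hP1 : ∀ s a, ∑ s' : S, P s a s' = 1) {π : S → A → ℝ} (hπ : isStoch π) :
    polMatS P π ∈ rowStochastic ℝ S := by
  refine mem_rowStochastic_iff_sum.2 ⟨fun s s' =>
    Finset.sum_nonneg fun a _ => mul_nonneg (hπ.1 s a) (hP0 s a s'), fun s => ?_⟩
  simp only [polMatS, of_apply]
  rw [Finset.sum_comm]
  simp only [← Finset.mul_sum, hP1, mul_one, hπ.2]

omit [DecidableEq S] in
lemma polMatS_mulVec (π : S → A → ℝ) (x : S → ℝ) (s : S) :
    (polMatS P π *ᵥ x) s = ∑ a, π s a * ∑ s', P s a s' * x s' := by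
  simp only [polMatS, mulVec, dotProduct, of_apply, Finset.sum_mul, Finset.mul_sum, mul_assoc]
  rw [Finset.sum_comm]

omit [Fintype S] [DecidableEq S] in
lemma weighted_average_le {π : S → A → ℝ} (hπ : isStoch π) {s : S} {f : A → ℝ} {b : ℝ}
    (hf : ∀ a, f a ≤ b) : ∑ a, π s a * f a ≤ b := by
  calc ∑ a, π s a * f a ≤ ∑ a, π s a * b :=
        Finset.sum_le_sum fun a _ => mul_le_mul_of_nonneg_left (hf a) (hπ.1 s a)
    _ = b := by rw [← Finset.sum_mul, hπ.2, one_mul]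

omit [DecidableEq S] in
lemma exists_polMat_mulVec_ge [Nonempty A] {π : S → A → ℝ} (hπ : isStoch π) (x : S → ℝ) :
    ∃ g : S → A, ∀ s, (polMatS P π *ᵥ x) s ≤ (polMat P g *ᵥ x) s := by
  choose g hg using fun s => Finite.exists_max fun a => ∑ s', P s a s' * x s'
  refine ⟨g, fun s => ?_⟩
  rw [polMatS_mulVec]
  exact weighted_average_le hπ (hg s)

lemma exists_prod_polMat_mulVec_ge [Nonempty A] (hP0 : ∀ s a s', 0 ≤ P s a s')
    (hP1 : ∀ s a, ∑ s' : S, P s a s' = 1) {π : S → A → ℝ} (hπ : isStoch π) (ρ : S → A)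
    (m l : ℕ) (x : S → ℝ) :
    ∃ πs : ℕ → S → A, ∀ s, ((polMat P ρ ^ m * polMatS P π ^ l) *ᵥ x) s ≤
      (((List.range (m + l)).map fun t => polMat P (πs t)).prod *ᵥ x) s := by
  induction l generalizing x with
  | zero => exact ⟨fun _ => ρ, fun s => by simp⟩
  | succ l ih =>
    obtain ⟨g, hg⟩ := exists_polMat_mulVec_ge (P := P) hπ x
    obtain ⟨πs, hπs⟩ := ih (polMat P g *ᵥ x)
    refine ⟨Function.update πs (m + l) g, fun s => ?_⟩
    have hmem : polMat P ρ ^ m * polMatS P π ^ l ∈ rowStochastic ℝ S :=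
      mul_mem (pow_mem (polMat_mem_rowStochastic hP0 hP1 ρ) m)
        (pow_mem (polMatS_mem_rowStochastic hP0 hP1 hπ) l)
    have hmap : ((List.range (m + l)).map fun t => polMat P (Function.update πs (m + l) g t))
        = (List.range (m + l)).map fun t => polMat P (πs t) := by
      refine List.map_congr_left fun t ht => ?_
      rw [Function.update_of_ne (List.mem_range.1 ht).ne]
    rw [← add_assoc, List.range_succ, List.map_append, List.prod_append, hmap, List.map_singleton,
      List.prod_singleton, Function.update_self, pow_succ, ← mul_assoc,
      ← mulVec_mulVec x _ (polMatS P π), ← mulVec_mulVec x _ (polMat P g)]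
    exact (mulVec_le_mulVec_of_nonneg hmem.1 hg s).trans (hπs s)

/-- Concentrability extends from deterministic policies to powers of a stochastic policy. -/
lemma concentrability_pow_mul_pow [Nonempty A] (hP0 : ∀ s a s', 0 ≤ P s a s')
    (hP1 : ∀ s a, ∑ s' : S, P s a s' = 1) {μ ν : S → ℝ} (hμ0 : ∀ s, 0 ≤ μ s) {c : ℕ → ℝ}
    (hc : ∀ (i : ℕ) (πs : ℕ → S → A) (s : S),
      Matrix.vecMul μ (((List.range i).map fun t => polMat P (πs t)).prod) s ≤ c i * ν s)
    {π : S → A → ℝ} (hπ : isStoch π) (ρ : S → A) (m l : ℕ) {x : S → ℝ} (hx : ∀ s, 0 ≤ x s) :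
    μ ⬝ᵥ ((polMat P ρ ^ m * polMatS P π ^ l) *ᵥ x) ≤ c (m + l) * (ν ⬝ᵥ x) := by
  obtain ⟨πs, hπs⟩ := exists_prod_polMat_mulVec_ge hP0 hP1 hπ ρ m l x
  calc μ ⬝ᵥ ((polMat P ρ ^ m * polMatS P π ^ l) *ᵥ x)
      ≤ μ ⬝ᵥ (((List.range (m + l)).map fun t => polMat P (πs t)).prod *ᵥ x) :=
        Finset.sum_le_sum fun s _ => mul_le_mul_of_nonneg_left (hπs s) (hμ0 s)
    _ = (μ ᵥ* ((List.range (m + l)).map fun t => polMat P (πs t)).prod) ⬝ᵥ x :=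
        dotProduct_mulVec _ _ _
    _ ≤ ∑ s, c (m + l) * ν s * x s :=
        Finset.sum_le_sum fun s _ => mul_le_mul_of_nonneg_right (hc _ πs s) (hx s)
    _ = c (m + l) * (ν ⬝ᵥ x) := by simp only [dotProduct, Finset.mul_sum, mul_assoc]

lemma discounted_resolvent_le [Nonempty A] (hP0 : ∀ s a s', 0 ≤ P s a s')
    (hP1 : ∀ s a, ∑ s' : S, P s a s' = 1) {γ : ℝ} (hγ0 : 0 ≤ γ) (hγ1 : γ < 1)
    {μ ν : S → ℝ} (hμ0 : ∀ s, 0 ≤ μ s) (hν0 : ∀ s, 0 ≤ ν s)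
    {c : ℕ → ℝ} (hc0 : ∀ i, 0 ≤ c i)
    (hc : ∀ (i : ℕ) (πs : ℕ → S → A) (s : S),
      Matrix.vecMul μ (((List.range i).map fun t => polMat P (πs t)).prod) s ≤ c i * ν s)
    (hsum : Summable fun l : ℕ => γ ^ l * c l)
    {π : S → A → ℝ} (hπ : isStoch π) (ρ : S → A) (m : ℕ) {x : S → ℝ} (hx : ∀ s, 0 ≤ x s) :
    γ ^ m * (μ ⬝ᵥ (polMat P ρ ^ m *ᵥ ((1 - γ • polMatS P π)⁻¹ *ᵥ x))) ≤
      (∑' l : ℕ, γ ^ l * c l) * (ν ⬝ᵥ x) := by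
  have hM := polMatS_mem_rowStochastic hP0 hP1 hπ
  set M := polMatS P π
  set y := (1 - γ • M)⁻¹ *ᵥ x
  have hy0 : ∀ s, 0 ≤ y s := resolvent_mulVec_nonneg hM hγ0 hγ1 hx
  have hyrec : y = x + γ • (M *ᵥ y) := resolvent_mulVec hM hγ0 hγ1 x
  have hexp : ∀ n : ℕ, γ ^ m * (μ ⬝ᵥ (polMat P ρ ^ m *ᵥ y)) =
      ∑ l ∈ Finset.range n, γ ^ (m + l) * (μ ⬝ᵥ ((polMat P ρ ^ m * M ^ l) *ᵥ x)) +
        γ ^ (m + n) * (μ ⬝ᵥ ((polMat P ρ ^ m * M ^ n) *ᵥ y)) := by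
    intro n
    induction n with
    | zero => simp
    | succ n ih =>
      rw [ih, Finset.sum_range_succ, add_assoc]
      congr 1
      conv_lhs => rw [hyrec]
      rw [mulVec_add, dotProduct_add, mulVec_smul, dotProduct_smul, mulVec_mulVec, mul_assoc,
        ← pow_succ, smul_eq_mul, ← add_assoc, pow_succ γ (m + n)]
      ring
  have hνx : 0 ≤ ν ⬝ᵥ x := Finset.sum_nonneg fun s _ => mul_nonneg (hν0 s) (hx s)
  have hterm : ∀ j, 0 ≤ γ ^ j * c j := fun j => mul_nonneg (pow_nonneg hγ0 j) (hc0 j)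
  have hbound : ∀ n : ℕ, γ ^ m * (μ ⬝ᵥ (polMat P ρ ^ m *ᵥ y)) ≤
      (∑' l : ℕ, γ ^ l * c l) * (ν ⬝ᵥ x) + γ ^ (n + m) * c (n + m) * (ν ⬝ᵥ y) := by
    intro n
    rw [hexp n]
    refine add_le_add ?_ ?_
    · calc ∑ l ∈ Finset.range n, γ ^ (m + l) * (μ ⬝ᵥ ((polMat P ρ ^ m * M ^ l) *ᵥ x))
          ≤ ∑ l ∈ Finset.range n, γ ^ (m + l) * (c (m + l) * (ν ⬝ᵥ x)) :=
            Finset.sum_le_sum fun l _ => mul_le_mul_of_nonneg_left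
              (concentrability_pow_mul_pow hP0 hP1 hμ0 hc hπ ρ m l hx) (pow_nonneg hγ0 _)
        _ = (∑ l ∈ Finset.range n, γ ^ (m + l) * c (m + l)) * (ν ⬝ᵥ x) := by
            simp only [Finset.sum_mul, mul_assoc]
        _ ≤ _ := by
            refine mul_le_mul_of_nonneg_right ?_ hνx
            calc ∑ l ∈ Finset.range n, γ ^ (m + l) * c (m + l)
                = ∑ l ∈ (Finset.range n).map (addLeftEmbedding m), γ ^ l * c l := by
                  simp [Finset.sum_map]
              _ ≤ _ := hsum.sum_le_tsum _ fun j _ => hterm j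
    · rw [add_comm n m, mul_assoc]
      exact mul_le_mul_of_nonneg_left
        (concentrability_pow_mul_pow hP0 hP1 hμ0 hc hπ ρ m n hy0) (pow_nonneg hγ0 _)
  have hlim : Filter.Tendsto
      (fun n : ℕ => (∑' l : ℕ, γ ^ l * c l) * (ν ⬝ᵥ x) + γ ^ (n + m) * c (n + m) * (ν ⬝ᵥ y))
      Filter.atTop (nhds ((∑' l : ℕ, γ ^ l * c l) * (ν ⬝ᵥ x))) := by
    have h0 := ((Filter.tendsto_add_atTop_iff_nat m).2 hsum.tendsto_atTop_zero).mul_const (ν ⬝ᵥ y)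
    simpa using h0.const_add ((∑' l : ℕ, γ ^ l * c l) * (ν ⬝ᵥ x))
  exact ge_of_tendsto' hlim hbound

omit [Fintype A] [DecidableEq S] in
lemma bOp_eq (γ : ℝ) (r : S → ℝ) (π : S → A) (v : S → ℝ) (s : S) :
    bOp P γ r π v s = r s + γ * (polMat P π *ᵥ v) s := rfl

omit [DecidableEq S] in
lemma bOpS_eq (γ : ℝ) (r : S → ℝ) (π : S → A → ℝ) (v : S → ℝ) (s : S) :
    bOpS P γ r π v s = r s + γ * (polMatS P π *ᵥ v) s := rfl

omit [DecidableEq S] in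
lemma bOpS_mixPol_detPol [DecidableEq A] (γ : ℝ) (r : S → ℝ) (α : ℝ) (π : S → A → ℝ)
    (π' : S → A) (v : S → ℝ) (s : S) :
    bOpS P γ r (mixPol α π (detPol π')) v s =
      (1 - α) * bOpS P γ r π v s + α * bOp P γ r π' v s := by
  have h : ∑ a, detPol π' s a * ∑ s', P s a s' * v s' = (polMat P π' *ᵥ v) s := by
    simp [detPol, polMat, mulVec, dotProduct]
  rw [bOpS_eq, bOpS_eq, bOp_eq, polMatS_mulVec, polMatS_mulVec, ← h]
  simp only [mixPol, add_mul, Finset.sum_add_distrib, mul_assoc, ← Finset.mul_sum]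
  ring

lemma bOp_le_bOp_add_errOf [Nonempty A] (γ : ℝ) (r v : S → ℝ) (π π' : S → A) (s : S) :
    bOp P γ r π' v s ≤ bOp P γ r π v s + errOf P γ r v π s := by
  rw [errOf, add_sub_cancel]
  exact Finset.le_sup' (fun π' : S → A => bOp P γ r π' v s) (Finset.mem_univ π')

lemma bOpS_le_bOp_add_errOf [Nonempty A] (γ : ℝ) (r v : S → ℝ) (π : S → A)
    {ρ : S → A → ℝ} (hρ : isStoch ρ) (s : S) :
    bOpS P γ r ρ v s ≤ bOp P γ r π v s + errOf P γ r v π s := by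
  have h : bOpS P γ r ρ v s = ∑ a, ρ s a * bOp P γ r (fun _ => a) v s := by
    simp only [bOp, mul_add, Finset.sum_add_distrib, ← Finset.sum_mul, hρ.2, one_mul]
    rw [bOpS_eq, polMatS_mulVec, Finset.mul_sum]
    simp only [mul_left_comm]
  rw [h]
  exact weighted_average_le hρ fun a => bOp_le_bOp_add_errOf γ r v π (fun _ => a) s

lemma errOf_nonneg [Nonempty A] (γ : ℝ) (r v : S → ℝ) (π : S → A) (s : S) :
    0 ≤ errOf P γ r v π s := by
  linarith [bOp_le_bOp_add_errOf (P := P) γ r v π π s]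

omit [Fintype S] [DecidableEq S] in
lemma isStoch_cpiSeq [DecidableEq A] {π0 : S → A → ℝ} (hπ0 : isStoch π0) {αf : ℕ → ℝ}
    (hαf : ∀ i, 1 ≤ i → 0 < αf i ∧ αf i ≤ 1) (π'f : ℕ → S → A) (i : ℕ) :
    isStoch (cpiSeq π0 αf π'f i) := by
  induction i with
  | zero => exact hπ0
  | succ i ih =>
    obtain ⟨h0, h1⟩ := hαf (i + 1) (by omega)
    refine ⟨fun s a => ?_, fun s => ?_⟩
    · have hd : 0 ≤ detPol (π'f (i + 1)) s a := by unfold detPol; split_ifs <;> norm_num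
      exact add_nonneg (mul_nonneg (by linarith) (ih.1 s a)) (mul_nonneg h0.le hd)
    · simp only [cpiSeq, mixPol, Finset.sum_add_distrib, ← Finset.mul_sum, ih.2]
      simp [detPol]

/-- One conservative step contracts the distance to the value of `ρ`, up to the greedy error. -/
lemma sub_value_mixPol_le [DecidableEq A] [Nonempty A] (hP0 : ∀ s a s', 0 ≤ P s a s')
    (hP1 : ∀ s a, ∑ s' : S, P s a s' = 1) {γ : ℝ} (hγ0 : 0 ≤ γ) (hγ1 : γ < 1) {r : S → ℝ}
    {π : S → A → ℝ} (hπ : isStoch π) {α : ℝ} (hα0 : 0 ≤ α) {π' : S → A}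
    (hmix : isStoch (mixPol α π (detPol π'))) {v w u : S → ℝ} {ρ : S → A}
    (hv : bOpS P γ r π v = v) (hw : bOpS P γ r (mixPol α π (detPol π')) w = w)
    (hu : bOp P γ r ρ u = u) (s : S) :
    (u - w) s ≤ ((1 - α) • (u - v) + (α * γ) • (polMat P ρ *ᵥ (u - v)) +
      α • ((1 - γ • polMatS P (mixPol α π (detPol π')))⁻¹ *ᵥ errOf P γ r v π') : S → ℝ) s := by
  have hM := polMatS_mem_rowStochastic hP0 hP1 hmix
  have hTv := bOpS_mixPol_detPol (P := P) γ r α π π' v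
  rw [hv] at hTv
  simp only [bOpS_eq] at hTv
  have hw' := fun s => congrFun hw s
  simp only [bOpS_eq] at hw'
  set M := polMatS P (mixPol α π (detPol π'))
  set e := errOf P γ r v π'
  set y := (1 - γ • M)⁻¹ *ᵥ e
  have hyrec : ∀ s, y s = e s + γ * (M *ᵥ y) s :=
    fun s => congrFun (resolvent_mulVec hM hγ0 hγ1 e) s
  have hgain : ∀ s, 0 ≤ bOp P γ r π' v s + e s - v s := fun s => by
    have := bOpS_le_bOp_add_errOf γ r v π' hπ (P := P) s
    rw [hv] at this
    linarith
  have hq : ∀ s, (w - v + α • y) s = γ * (M *ᵥ (w - v + α • y)) s +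
      α * (bOp P γ r π' v s + e s - v s) := fun s => by
    simp only [mulVec_add, mulVec_sub, mulVec_smul, Pi.add_apply, Pi.sub_apply, Pi.smul_apply,
      smul_eq_mul]
    linear_combination -hw' s + hTv s + α * hyrec s
  have hq0 : ∀ s, 0 ≤ (w - v + α • y) s :=
    nonneg_of_discounted_mulVec_le hM hγ0 hγ1 fun s => by
      linarith [hq s, mul_nonneg hα0 (hgain s)]
  have hMq := mul_nonneg hγ0 (mulVec_nonneg_of_nonneg hM.1 hq0 s)
  have hmono := mul_le_mul_of_nonneg_left (bOp_le_bOp_add_errOf (P := P) γ r v π' ρ s) hα0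
  have hqs := hq s
  have hus := congrFun hu s
  rw [bOp_eq] at hus
  rw [bOp_eq γ r ρ] at hmono
  simp only [mulVec_sub, Pi.add_apply, Pi.sub_apply, Pi.smul_apply, smul_eq_mul] at hqs ⊢
  linear_combination -hqs + hMq + hmono - α * hus

end Policies

/-- Performance of a CPI sequence in terms of the total step `∑ α_i`. -/
lemma cpiSeq_discounted_loss_le {S A : Type*} [Fintype S] [Fintype A] [DecidableEq S]
    [DecidableEq A] [Nonempty A]
    {P : S → A → S → ℝ} (hP0 : ∀ s a s', 0 ≤ P s a s')
    (hP1 : ∀ s a, ∑ s' : S, P s a s' = 1)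
    {γ : ℝ} (hγ0 : 0 < γ) (hγ1 : γ < 1)
    {Vmax : ℝ} {r : S → ℝ} (hr : ∀ s, |r s| ≤ (1 - γ) * Vmax) (hVmax : 0 ≤ Vmax)
    {πstar : S → A} {vstar : S → ℝ} (hfix : bOp P γ r πstar vstar = vstar)
    {μ ν : S → ℝ} (hμ0 : ∀ s, 0 ≤ μ s) (hμ1 : ∑ s : S, μ s = 1) (hν0 : ∀ s, 0 ≤ ν s)
    {c : ℕ → ℝ} (hc0 : ∀ i, 0 ≤ c i)
    (hc : ∀ (i : ℕ) (πs : ℕ → S → A) (s : S),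
      Matrix.vecMul μ (((List.range i).map fun t => polMat P (πs t)).prod) s ≤ c i * ν s)
    (hsum : Summable fun l : ℕ => γ ^ l * c l)
    {π0 : S → A → ℝ} (hπ0 : isStoch π0)
    {αf : ℕ → ℝ} (hαf : ∀ i, 1 ≤ i → 0 < αf i ∧ αf i ≤ 1)
    {π'f : ℕ → S → A} {vS : ℕ → S → ℝ}
    (hvS : ∀ i : ℕ, bOpS P γ r (cpiSeq π0 αf π'f i) (vS i) = vS i)
    {ε : ℝ}
    (herr : ∀ i, ν ⬝ᵥ errOf P γ r (vS i) (π'f (i + 1)) ≤ ε / (1 - γ)) (k m : ℕ) :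
    γ ^ m * (μ ⬝ᵥ (polMat P πstar ^ m *ᵥ (vstar - vS k))) ≤
      γ ^ m * (2 * Vmax * Real.exp (-((1 - γ) * ∑ i ∈ Finset.Icc 1 k, αf i))) +
        (∑' l : ℕ, γ ^ l * c l) * (ε / (1 - γ)) * ∑ i ∈ Finset.Icc 1 k, αf i := by
  have hstar := polMat_mem_rowStochastic hP0 hP1 πstar
  have hstoch := isStoch_cpiSeq hπ0 hαf π'f
  have hT : 0 ≤ ∑' l : ℕ, γ ^ l * c l :=
    tsum_nonneg fun l => mul_nonneg (pow_nonneg hγ0.le l) (hc0 l)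
  induction k generalizing m with
  | zero =>
    have h1 : ∀ s, (vstar - vS 0) s ≤ 2 * Vmax := fun s => by
      have hs := abs_le_of_discounted_fixed_point hstar hγ0.le hγ1 hr
        (fun s => (congrFun hfix s).symm) s
      have h0 := abs_le_of_discounted_fixed_point
        (polMatS_mem_rowStochastic hP0 hP1 (hstoch 0)) hγ0.le hγ1 hr
        (fun s => (congrFun (hvS 0) s).symm) s
      rw [Pi.sub_apply]
      linarith [(abs_le.1 hs).2, (abs_le.1 h0).1]
    have hm := pow_mem hstar m
    have h2 : ∀ s, (polMat P πstar ^ m *ᵥ (vstar - vS 0)) s ≤ 2 * Vmax := fun s =>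
      (mulVec_le_mulVec_of_nonneg hm.1 h1 s).trans_eq (mulVec_const_of_mem_rowStochastic hm _ s)
    have h3 : μ ⬝ᵥ (polMat P πstar ^ m *ᵥ (vstar - vS 0)) ≤ 2 * Vmax := by
      calc _ ≤ ∑ s, μ s * (2 * Vmax) :=
            Finset.sum_le_sum fun s _ => mul_le_mul_of_nonneg_left (h2 s) (hμ0 s)
        _ = 2 * Vmax := by rw [← Finset.sum_mul, hμ1, one_mul]
    simpa using mul_le_mul_of_nonneg_left h3 (pow_nonneg hγ0.le m)
  | succ k ih =>
    obtain ⟨hα0, hα1⟩ := hαf (k + 1) (by omega)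
    have hstep := sub_value_mixPol_le hP0 hP1 hγ0.le hγ1 (hstoch k) hα0.le (hstoch (k + 1))
      (hvS k) (hvS (k + 1)) hfix
    have he := errOf_nonneg (P := P) γ r (vS k) (π'f (k + 1))
    have hres := discounted_resolvent_le hP0 hP1 hγ0.le hγ1 hμ0 hν0 hc0 hc hsum
      (hstoch (k + 1)) πstar m he
    have hres' := hres.trans (mul_le_mul_of_nonneg_left (herr k) hT)
    have hmono : μ ⬝ᵥ (polMat P πstar ^ m *ᵥ (vstar - vS (k + 1))) ≤ _ :=
      Finset.sum_le_sum fun s _ => mul_le_mul_of_nonneg_left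
        (mulVec_le_mulVec_of_nonneg (pow_mem hstar m).1 hstep s) (hμ0 s)
    change _ ≤ μ ⬝ᵥ _ at hmono
    change γ ^ m * (μ ⬝ᵥ (polMat P πstar ^ m *ᵥ ((1 - γ • polMatS P (mixPol (αf (k + 1))
      (cpiSeq π0 αf π'f k) (detPol (π'f (k + 1)))))⁻¹ *ᵥ _))) ≤ _ at hres'
    simp only [mulVec_add, mulVec_smul, dotProduct_add, dotProduct_smul, smul_eq_mul,
      mulVec_mulVec _ (polMat P πstar ^ m) (polMat P πstar), ← pow_succ] at hmono
    have hmono' := mul_le_mul_of_nonneg_left hmono (pow_nonneg hγ0.le m)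
    have ih0 := mul_le_mul_of_nonneg_left (ih m) (sub_nonneg.2 hα1)
    have ih1 := mul_le_mul_of_nonneg_left (ih (m + 1)) hα0.le
    have hres2 := mul_le_mul_of_nonneg_left hres' hα0.le
    rw [pow_succ] at ih1
    rw [Finset.sum_Icc_succ_top (by omega : 1 ≤ k + 1)]
    set σ := ∑ i ∈ Finset.Icc 1 k, αf i
    set a := αf (k + 1)
    have hexp : 2 * Vmax * Real.exp (-((1 - γ) * σ)) * (1 - a * (1 - γ)) ≤
        2 * Vmax * Real.exp (-((1 - γ) * (σ + a))) := by
      rw [mul_add, neg_add, Real.exp_add, ← mul_assoc]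
      refine mul_le_mul_of_nonneg_left ?_ (by positivity)
      linarith [Real.add_one_le_exp (-((1 - γ) * a))]
    have hexp' := mul_le_mul_of_nonneg_left hexp (pow_nonneg hγ0.le m)
    linarith

/-- for a CPI sequence with steps `α_i ∈ (0,1]`, `d_{π_{i−1},ν} e_i ≤ ε`
for all `i ≥ 1`, `ε ∈ (0, 2Vmax]` and `C^{(1,0)} = (1−γ)Σ_l γ^l c(l) < ∞`:
(a) whenever `Σ_{i=1}^{k} α_i ≥ log(2Vmax/ε)/(1−γ)`,
`μ(v_{π*} − v_{π_k}) ≤ (C^{(1,0)}(Σ_{i=1}^{k}α_i)/(1−γ)^2 + 1) ε`;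
(b) if moreover `α_i ≥ (1−γ)ε/(12γVmax)` for all `i ≥ 1`, the smallest such `k`,
namely `k†`, satisfies `k† ≤ (12γVmax/((1−γ)ε))(log(2Vmax/ε)/(1−γ) + 1)` and
`μ(v_{π*} − v_{π_{k†}}) ≤ (C^{(1,0)}(log(2Vmax/ε)/(1−γ) + 1)/(1−γ)^2 + 1) ε`. -/
theorem stmt13
    {S A : Type*} [Fintype S] [Fintype A] [DecidableEq S] [DecidableEq A]
    [Nonempty S] [Nonempty A]
    (P : S → A → S → ℝ) (hP0 : ∀ s a s', 0 ≤ P s a s')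
    (hP1 : ∀ s a, ∑ s' : S, P s a s' = 1)
    (γ : ℝ) (hγ0 : 0 < γ) (hγ1 : γ < 1)
    (Rmax Vmax : ℝ) (r : S → ℝ) (hr : ∀ s, |r s| ≤ Rmax)
    (hVmax : Vmax = Rmax / (1 - γ))
    (πstar : S → A) (vstar : S → ℝ)
    (hfix : bOp P γ r πstar vstar = vstar)
    (hopt : ∀ (π : S → A) (v : S → ℝ), bOp P γ r π v = v → ∀ s, v s ≤ vstar s)
    (μ ν : S → ℝ) (hμ0 : ∀ s, 0 ≤ μ s) (hμ1 : ∑ s : S, μ s = 1)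
    (hν0 : ∀ s, 0 ≤ ν s) (hν1 : ∑ s : S, ν s = 1)
    (c : ℕ → ℝ) (hc0 : ∀ i, 0 ≤ c i)
    (hc : ∀ (i : ℕ) (πs : ℕ → S → A) (s : S),
      Matrix.vecMul μ (((List.range i).map fun t => polMat P (πs t)).prod) s ≤ c i * ν s)
    (hsum : Summable fun l : ℕ => γ ^ l * c l)
    (π0 : S → A → ℝ) (hπ0 : isStoch π0)
    (αf : ℕ → ℝ) (hαf : ∀ i, 1 ≤ i → 0 < αf i ∧ αf i ≤ 1)
    (π'f : ℕ → S → A)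
    (vS : ℕ → S → ℝ)
    (hvS : ∀ i : ℕ, bOpS P γ r (cpiSeq π0 αf π'f i) (vS i) = vS i)
    (ε : ℝ) (hε0 : 0 < ε) (hε1 : ε ≤ 2 * Vmax)
    (herr : ∀ i, 1 ≤ i →
      (∑ s : S, ((1 - γ) • Matrix.vecMul ν
          (1 - γ • polMatS P (cpiSeq π0 αf π'f (i - 1)))⁻¹) s
        * errOf P γ r (vS (i - 1)) (π'f i) s) ≤ ε) :
    (∀ k : ℕ, Real.log (2 * Vmax / ε) / (1 - γ) ≤ ∑ i ∈ Finset.Icc 1 k, αf i →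
      (∑ s : S, μ s * (vstar s - vS k s)) ≤
        (((1 - γ) * ∑' l : ℕ, γ ^ l * c l) * (∑ i ∈ Finset.Icc 1 k, αf i) / (1 - γ) ^ 2
          + 1) * ε)
    ∧ ((∀ i, 1 ≤ i → (1 - γ) * ε / (12 * γ * Vmax) ≤ αf i) →
        ∀ kd : ℕ,
          (Real.log (2 * Vmax / ε) / (1 - γ) ≤ ∑ i ∈ Finset.Icc 1 kd, αf i ∧
            ∀ k' < kd,
              ¬ Real.log (2 * Vmax / ε) / (1 - γ) ≤ ∑ i ∈ Finset.Icc 1 k', αf i) →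
          (kd : ℝ) ≤ 12 * γ * Vmax / ((1 - γ) * ε)
              * (Real.log (2 * Vmax / ε) / (1 - γ) + 1)
          ∧ (∑ s : S, μ s * (vstar s - vS kd s)) ≤
              (((1 - γ) * ∑' l : ℕ, γ ^ l * c l)
                  * (Real.log (2 * Vmax / ε) / (1 - γ) + 1) / (1 - γ) ^ 2 + 1) * ε) := by
  have hγ : 0 < 1 - γ := sub_pos.2 hγ1
  have hV : 0 < Vmax := by linarith
  have hr' : ∀ s, |r s| ≤ (1 - γ) * Vmax := fun s => by
    rw [hVmax, mul_div_cancel₀ _ hγ.ne']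
    exact hr s
  have hT : 0 ≤ ∑' l : ℕ, γ ^ l * c l :=
    tsum_nonneg fun l => mul_nonneg (pow_nonneg hγ0.le l) (hc0 l)
  have hstoch := isStoch_cpiSeq hπ0 hαf π'f
  have herr' : ∀ i, ν ⬝ᵥ errOf P γ r (vS i) (π'f (i + 1)) ≤ ε / (1 - γ) := fun i => by
    have h := herr (i + 1) (by omega)
    rw [Nat.add_sub_cancel] at h
    change ((1 - γ) • Matrix.vecMul ν (1 - γ • polMatS P (cpiSeq π0 αf π'f i))⁻¹) ⬝ᵥ
      errOf P γ r (vS i) (π'f (i + 1)) ≤ ε at h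
    rw [smul_dotProduct, ← dotProduct_mulVec, smul_eq_mul, mul_comm, ← le_div_iff₀ hγ] at h
    refine le_trans (Finset.sum_le_sum fun s _ => mul_le_mul_of_nonneg_left ?_ (hν0 s)) h
    exact le_resolvent_mulVec (polMatS_mem_rowStochastic hP0 hP1 (hstoch i)) hγ0.le hγ1
      (errOf_nonneg γ r _ _) s
  have hloss : ∀ k : ℕ, Real.log (2 * Vmax / ε) / (1 - γ) ≤ ∑ i ∈ Finset.Icc 1 k, αf i →
      (∑ s : S, μ s * (vstar s - vS k s)) ≤
        (((1 - γ) * ∑' l : ℕ, γ ^ l * c l) * (∑ i ∈ Finset.Icc 1 k, αf i) / (1 - γ) ^ 2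
          + 1) * ε := by
    intro k hk
    have h := cpiSeq_discounted_loss_le hP0 hP1 hγ0 hγ1 hr' hV.le hfix hμ0 hμ1 hν0 hc0 hc hsum
      hπ0 hαf hvS herr' k 0
    simp only [pow_zero, one_mul, one_mulVec] at h
    change μ ⬝ᵥ (vstar - vS k) ≤ _
    refine h.trans ?_
    have hexp : 2 * Vmax * Real.exp (-((1 - γ) * ∑ i ∈ Finset.Icc 1 k, αf i)) ≤ ε := by
      have h1 : Real.exp (-((1 - γ) * ∑ i ∈ Finset.Icc 1 k, αf i)) ≤
          Real.exp (-Real.log (2 * Vmax / ε)) := by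
        rw [div_le_iff₀ hγ] at hk
        exact Real.exp_le_exp.2 (by linarith)
      rw [Real.exp_neg (Real.log _), Real.exp_log (by positivity), inv_div] at h1
      calc _ ≤ 2 * Vmax * (ε / (2 * Vmax)) := mul_le_mul_of_nonneg_left h1 (by positivity)
        _ = ε := by field_simp
    calc _ ≤ ε + (∑' l : ℕ, γ ^ l * c l) * (ε / (1 - γ)) * ∑ i ∈ Finset.Icc 1 k, αf i := by
          gcongr
      _ = _ := by field_simp; ring
  refine ⟨hloss, fun hα kd ⟨hkd, hmin⟩ => ?_⟩
  have hlog : 0 ≤ Real.log (2 * Vmax / ε) / (1 - γ) :=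
    div_nonneg (Real.log_nonneg ((one_le_div hε0).2 hε1)) hγ.le
  have hle : ∑ i ∈ Finset.Icc 1 kd, αf i ≤ Real.log (2 * Vmax / ε) / (1 - γ) + 1 := by
    cases kd with
    | zero => simpa using add_nonneg hlog zero_le_one
    | succ n =>
      rw [Finset.sum_Icc_succ_top (by omega : 1 ≤ n + 1)]
      linarith [not_le.1 (hmin n n.lt_succ_self), (hαf (n + 1) (by omega)).2]
  refine ⟨?_, (hloss kd hkd).trans ?_⟩
  · have hcard : (kd : ℝ) * ((1 - γ) * ε / (12 * γ * Vmax)) ≤ ∑ i ∈ Finset.Icc 1 kd, αf i := by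
      have := Finset.card_nsmul_le_sum (Finset.Icc 1 kd) αf _
        fun i hi => hα i (Finset.mem_Icc.1 hi).1
      simpa using this
    have h := hcard.trans hle
    rw [← le_div_iff₀ (by positivity), div_div_eq_mul_div] at h
    exact h.trans_eq (by ring)
  · gcongr
end
end

section
/- CPI(α): let (π_i)_{i≥0} be a CPI sequence with constant step α_i = α ∈ (0,1], suppose d_{π_{i−1},ν} e_i ≤ ε for all i ≥ 1 where ε ∈ (0, 2Vmax], and assume C^{(1,0)} := (1−γ)Σ_{l≥0}γ^l c(l) < ∞. If k = ⌈log(2Vmax/ε)/(α(1−γ))⌉, then μ(v_{π*} − v_{π_k}) ≤ (αk C^{(1,0)}/(1−γ)^2 + 1) ε ≤ (C^{(1,0)}(log(2Vmax/ε)/(1−γ) + 1)/(1−γ)^2 + 1) ε. -/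
open Finset Matrix

noncomputable section

theorem nonneg_of_discounted_le {S : Type*} [Fintype S] [Nonempty S] {γ : ℝ}
    (hγ0 : 0 < γ) (hγ1 : γ < 1) (Q : S → S → ℝ) (hQ0 : ∀ s s', 0 ≤ Q s s')
    (hQ1 : ∀ s, ∑ s', Q s s' = 1) (x : S → ℝ)
    (hx : ∀ s, γ * ∑ s', Q s s' * x s' ≤ x s) (s : S) : 0 ≤ x s := by
  obtain ⟨m, -, hm⟩ := Finset.exists_min_image Finset.univ x Finset.univ_nonempty
  have h1 : x m ≤ ∑ s', Q m s' * x s' := by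
    calc x m = ∑ s', Q m s' * x m := by rw [← Finset.sum_mul, hQ1, one_mul]
      _ ≤ _ := Finset.sum_le_sum fun s' _ =>
          mul_le_mul_of_nonneg_left (hm s' (Finset.mem_univ _)) (hQ0 _ _)
  have h2 := hx m
  have h3 : 0 ≤ x m := by
    nlinarith [mul_le_mul_of_nonneg_left h1 hγ0.le]
  exact h3.trans (hm s (Finset.mem_univ _))

theorem sum_mul_le_occupancy {S : Type*} [Fintype S] [DecidableEq S] [Nonempty S] {γ : ℝ}
    (hγ0 : 0 < γ) (hγ1 : γ < 1) (Q : Matrix S S ℝ) (hQ0 : ∀ s s', 0 ≤ Q s s')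
    (hQ1 : ∀ s, ∑ s', Q s s' = 1) (ν e : S → ℝ) (hν : ∀ s, 0 ≤ ν s) (he : ∀ s, 0 ≤ e s) :
    (1 - γ) * ∑ s, ν s * e s ≤
      ∑ s, ((1 - γ) • Matrix.vecMul ν (1 - γ • Q)⁻¹) s * e s := by
  have hval : ∀ (x : S → ℝ) s,
      ((1 - γ • Q) *ᵥ x) s = x s - γ * ∑ s', Q s s' * x s' := by
    intro x s
    rw [Matrix.sub_mulVec, Matrix.one_mulVec, Matrix.smul_mulVec]
    simp [Matrix.mulVec, dotProduct]
  have hpos : ∀ x : S → ℝ, (∀ s, 0 ≤ ((1 - γ • Q) *ᵥ x) s) → ∀ s, 0 ≤ x s := by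
    intro x hx
    refine nonneg_of_discounted_le hγ0 hγ1 Q hQ0 hQ1 x fun s => ?_
    have := hx s
    rw [hval] at this
    linarith
  have hunit : IsUnit (1 - γ • Q) := by
    rw [← Matrix.mulVec_injective_iff_isUnit]
    intro x y hxy
    ext s
    have hxy' : (1 - γ • Q) *ᵥ x = (1 - γ • Q) *ᵥ y := hxy
    have h1 := hpos (x - y) (by intro s; rw [Matrix.mulVec_sub, hxy']; simp) s
    have h2 := hpos (y - x) (by intro s; rw [Matrix.mulVec_sub, hxy']; simp) s
    simp only [Pi.sub_apply] at h1 h2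
    linarith
  set y := (1 - γ • Q)⁻¹ *ᵥ e with hy
  have hye : (1 - γ • Q) *ᵥ y = e := by
    rw [hy, Matrix.mulVec_mulVec,
      Matrix.mul_nonsing_inv _ ((Matrix.isUnit_iff_isUnit_det _).1 hunit), Matrix.one_mulVec]
  have hy0 : ∀ s, 0 ≤ y s := hpos y (by rw [hye]; exact he)
  have hle : ∀ s, e s ≤ y s := by
    intro s
    have h1 := hval y s
    rw [hye] at h1
    have h2 : 0 ≤ ∑ s', Q s s' * y s' :=
      Finset.sum_nonneg fun s' _ => mul_nonneg (hQ0 _ _) (hy0 _)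
    nlinarith [mul_nonneg hγ0.le h2]
  have heq : ∑ s, ((1 - γ) • Matrix.vecMul ν (1 - γ • Q)⁻¹) s * e s
      = (1 - γ) * ∑ s, ν s * y s := by
    have h := Matrix.dotProduct_mulVec ν (1 - γ • Q)⁻¹ e
    rw [← hy] at h
    change _ = (1 - γ) * (ν ⬝ᵥ y)
    rw [h, dotProduct, Finset.mul_sum]
    exact Finset.sum_congr rfl fun s _ => by simp [mul_assoc]
  rw [heq]
  exact mul_le_mul_of_nonneg_left
    (Finset.sum_le_sum fun s _ => mul_le_mul_of_nonneg_left (hle s) (hν s)) (by linarith)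

/-- Value iteration started above: every iterate dominates its own Bellman update for the
reward `e`, and is generated by a finite sequence of deterministic policies. -/
theorem exists_superharmonic_expansion {S A : Type*} [Fintype S] [DecidableEq S] [Fintype A]
    [Nonempty A] (P : S → A → S → ℝ) (hP0 : ∀ s a s', 0 ≤ P s a s')
    (hP1 : ∀ s a, ∑ s', P s a s' = 1) {γ : ℝ} (hγ0 : 0 < γ) (e : S → ℝ) (K : ℝ)
    (hK : ∀ s, e s + γ * K ≤ K) (n : ℕ) :
    ∃ (U : S → ℝ) (πs : ℕ → S → A),
      (∀ s a, e s + γ * ∑ s', P s a s' * U s' ≤ U s) ∧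
      U = ∑ l ∈ Finset.range n,
          γ ^ l • ((((List.range l).map fun t => polMat P (πs t)).prod) *ᵥ e)
        + γ ^ n • fun _ => K := by
  induction n with
  | zero =>
    refine ⟨fun _ => K, fun _ _ => Classical.arbitrary A, fun s a => ?_, by simp⟩
    rw [← Finset.sum_mul, hP1, one_mul]
    exact hK s
  | succ n ih =>
    obtain ⟨U, πs, hU, hexp⟩ := ih
    let f : S → A → ℝ := fun s a => e s + γ * ∑ s', P s a s' * U s'
    choose σ hσ using fun s => Finite.exists_max (f s)
    have hle : ∀ s, f s (σ s) ≤ U s := fun s => hU s _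
    refine ⟨fun s => f s (σ s), fun t => Nat.casesOn t σ πs, fun s a => ?_, ?_⟩
    · refine le_trans ?_ (hσ s a)
      refine add_le_add le_rfl (mul_le_mul_of_nonneg_left ?_ hγ0.le)
      exact Finset.sum_le_sum fun s' _ => mul_le_mul_of_nonneg_left (hle s') (hP0 _ _ _)
    · have h1 : (fun s => f s (σ s)) = e + γ • (polMat P σ *ᵥ U) := by
        ext s
        simp [f, polMat, Matrix.mulVec, dotProduct]
      have hconst : polMat P σ *ᵥ (fun _ : S => K) = fun _ => K := by
        ext s
        simp [polMat, Matrix.mulVec, dotProduct, ← Finset.sum_mul, hP1]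
      rw [h1, hexp, Finset.sum_range_succ', Matrix.mulVec_add, Matrix.mulVec_sum,
        Matrix.mulVec_smul, hconst]
      simp only [Matrix.mulVec_smul, Matrix.mulVec_mulVec, List.range_succ_eq_map,
        List.map_cons, List.map_map, List.prod_cons, smul_add, Finset.smul_sum, smul_smul,
        Function.comp_def, pow_succ', List.range_zero, List.map_nil, List.prod_nil, pow_zero,
        Matrix.one_mulVec, one_smul]
      rw [← add_assoc, add_comm e]
      rfl

/-- A function dominating its own Bellman update for the reward `e`, whose `μ`-average is
controlled by the concentrability coefficients. -/
theorem exists_superharmonic_le {S A : Type*} [Fintype S] [DecidableEq S] [Fintype A]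
    [Nonempty A] (P : S → A → S → ℝ) (hP0 : ∀ s a s', 0 ≤ P s a s')
    (hP1 : ∀ s a, ∑ s', P s a s' = 1) {γ : ℝ} (hγ0 : 0 < γ) (hγ1 : γ < 1)
    (μ ν : S → ℝ) (hμ1 : ∑ s, μ s = 1) (hν0 : ∀ s, 0 ≤ ν s)
    (c : ℕ → ℝ) (hc0 : ∀ i, 0 ≤ c i)
    (hc : ∀ (i : ℕ) (πs : ℕ → S → A) (s : S),
      Matrix.vecMul μ (((List.range i).map fun t => polMat P (πs t)).prod) s ≤ c i * ν s)
    (hsum : Summable fun l : ℕ => γ ^ l * c l)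
    (e : S → ℝ) (he : ∀ s, 0 ≤ e s) {δ : ℝ} (hδ : 0 < δ) :
    ∃ U : S → ℝ, (∀ s a, e s + γ * ∑ s', P s a s' * U s' ≤ U s) ∧
      ∑ s, μ s * U s ≤ (∑' l : ℕ, γ ^ l * c l) * (∑ s, ν s * e s) + δ := by
  set K := (∑ s, e s) / (1 - γ) with hKdef
  have hK : ∀ s, e s + γ * K ≤ K := by
    intro s
    have h1 : e s ≤ ∑ s, e s := Finset.single_le_sum (fun s _ => he s) (Finset.mem_univ s)
    have h2 : (1 - γ) * K = ∑ s, e s := by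
      rw [hKdef]; field_simp [(by linarith : (1 - γ) ≠ 0)]
    linarith
  have hlim : Filter.Tendsto (fun n : ℕ => γ ^ n * K) Filter.atTop (nhds 0) := by
    simpa using (tendsto_pow_atTop_nhds_zero_of_lt_one hγ0.le hγ1).mul_const K
  obtain ⟨n, hn⟩ := (hlim.eventually (gt_mem_nhds hδ)).exists
  obtain ⟨U, πs, hU, hexp⟩ := exists_superharmonic_expansion P hP0 hP1 hγ0 e K hK n
  refine ⟨U, hU, ?_⟩
  have hνe : 0 ≤ ∑ s, ν s * e s := Finset.sum_nonneg fun s _ => mul_nonneg (hν0 s) (he s)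
  have hmu : ∑ s, μ s * U s = ∑ l ∈ Finset.range n, γ ^ l *
      (Matrix.vecMul μ (((List.range l).map fun t => polMat P (πs t)).prod) ⬝ᵥ e)
      + γ ^ n * K := by
    change μ ⬝ᵥ U = _
    rw [hexp, dotProduct_add, dotProduct_sum, dotProduct_smul]
    congr 1
    · exact Finset.sum_congr rfl fun l _ => by
        rw [dotProduct_smul, Matrix.dotProduct_mulVec, smul_eq_mul]
    · simp [dotProduct, ← Finset.sum_mul, hμ1]
  have hterm : ∀ l, γ ^ l *
      (Matrix.vecMul μ (((List.range l).map fun t => polMat P (πs t)).prod) ⬝ᵥ e)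
      ≤ γ ^ l * c l * ∑ s, ν s * e s := by
    intro l
    rw [mul_assoc]
    refine mul_le_mul_of_nonneg_left ?_ (pow_nonneg hγ0.le _)
    rw [Finset.mul_sum]
    refine Finset.sum_le_sum fun s _ => ?_
    rw [← mul_assoc]
    exact mul_le_mul_of_nonneg_right (hc l πs s) (he s)
  rw [hmu]
  refine add_le_add ?_ hn.le
  refine (Finset.sum_le_sum fun l _ => hterm l).trans ?_
  rw [← Finset.sum_mul]
  exact mul_le_mul_of_nonneg_right
    (hsum.sum_le_tsum _ fun l _ => mul_nonneg (pow_nonneg hγ0.le _) (hc0 l)) hνe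

theorem isStoch_cpiSeq_s14 {S A : Type*} [Fintype A] [DecidableEq A] {π0 : S → A → ℝ}
    (hπ0 : isStoch π0) {α : ℝ} (hα0 : 0 < α) (hα1 : α ≤ 1) (π'f : ℕ → S → A) (i : ℕ) :
    isStoch (cpiSeq π0 (fun _ => α) π'f i) := by
  induction i with
  | zero => exact hπ0
  | succ i ih =>
    refine ⟨fun s a => ?_, fun s => ?_⟩
    · have h1 := ih.1 s a
      have h2 : 0 ≤ detPol (π'f (i + 1)) s a := by unfold detPol; split_ifs <;> norm_num
      exact add_nonneg (mul_nonneg (by linarith) h1) (mul_nonneg hα0.le h2)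
    · have h := ih.2 s
      simp only [cpiSeq, mixPol, Finset.sum_add_distrib, ← Finset.mul_sum, h]
      simp [detPol]

theorem bOpS_eq_sum {S A : Type*} [Fintype S] [Fintype A] (P : S → A → S → ℝ) (γ : ℝ)
    (r : S → ℝ) {π : S → A → ℝ} (hπ : isStoch π) (v : S → ℝ) (s : S) :
    bOpS P γ r π v s = ∑ a, π s a * (r s + γ * ∑ s', P s a s' * v s') := by
  simp only [bOpS, mul_add, Finset.sum_add_distrib, ← Finset.sum_mul, hπ.2 s, one_mul]
  congr 1
  simp only [Finset.sum_mul, Finset.mul_sum]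
  rw [Finset.sum_comm]
  exact Finset.sum_congr rfl fun a _ => Finset.sum_congr rfl fun s' _ => by ring

theorem polMatS_nonneg {S A : Type*} [Fintype A] {P : S → A → S → ℝ}
    (hP0 : ∀ s a s', 0 ≤ P s a s') {π : S → A → ℝ} (hπ : isStoch π) (s s' : S) :
    0 ≤ polMatS P π s s' :=
  Finset.sum_nonneg fun a _ => mul_nonneg (hπ.1 s a) (hP0 s a s')

theorem polMatS_sum {S A : Type*} [Fintype S] [Fintype A] {P : S → A → S → ℝ}
    (hP1 : ∀ s a, ∑ s', P s a s' = 1) {π : S → A → ℝ} (hπ : isStoch π) (s : S) :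
    ∑ s', polMatS P π s s' = 1 := by
  simp only [polMatS, Matrix.of_apply]
  rw [Finset.sum_comm]
  simp only [← Finset.mul_sum, hP1, mul_one, hπ.2 s]

/-- One step of CPI from a policy of value `v` to its mixture, of value `w`, with a
deterministic policy: the loss against `πstar` contracts, up to the greedy error `e`. -/
theorem cpi_step {S A : Type*} [Fintype S] [Fintype A] [DecidableEq S] [DecidableEq A]
    [Nonempty S] [Nonempty A] (P : S → A → S → ℝ) (hP0 : ∀ s a s', 0 ≤ P s a s')
    (hP1 : ∀ s a, ∑ s', P s a s' = 1) {γ : ℝ} (hγ0 : 0 < γ) (hγ1 : γ < 1) (r : S → ℝ)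
    (πstar : S → A) (vstar : S → ℝ) (hfix : bOp P γ r πstar vstar = vstar)
    {α : ℝ} (hα0 : 0 < α) (π : S → A → ℝ) (π' : S → A) (hπ : isStoch π)
    (hmix : isStoch (mixPol α π (detPol π'))) (v w U : S → ℝ)
    (hv : bOpS P γ r π v = v) (hw : bOpS P γ r (mixPol α π (detPol π')) w = w)
    (hU : ∀ s a, errOf P γ r v π' s + γ * ∑ s', P s a s' * U s' ≤ U s) (s : S) :
    vstar s - w s ≤ (1 - α) * (vstar s - v s)
      + α * (γ * ∑ s', P s (πstar s) s' * (vstar s' - v s')) + α * U s := by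
  set M : S → ℝ := fun s => Finset.univ.sup' Finset.univ_nonempty
    fun π' : S → A => bOp P γ r π' v s with hM
  set e := errOf P γ r v π' with he
  have heM : ∀ s, e s = M s - bOp P γ r π' v s := fun s => rfl
  have hMle : ∀ (σ : S → A) s, bOp P γ r σ v s ≤ M s := fun σ s =>
    Finset.le_sup' (fun σ : S → A => bOp P γ r σ v s) (Finset.mem_univ σ)
  have hMv : ∀ s, v s ≤ M s := by
    intro s
    rw [← congrFun hv s, bOpS_eq_sum P γ r hπ]
    calc _ ≤ ∑ a, π s a * M s := Finset.sum_le_sum fun a _ =>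
          mul_le_mul_of_nonneg_left (hMle (fun _ => a) s) (hπ.1 s a)
      _ = M s := by rw [← Finset.sum_mul, hπ.2 s, one_mul]
  set Q := polMatS P (mixPol α π (detPol π')) with hQ
  have hTmix : ∀ s, bOpS P γ r (mixPol α π (detPol π')) v s
      = (1 - α) * v s + α * bOp P γ r π' v s := by
    intro s
    have h1 := congrFun hv s
    rw [bOpS_eq_sum P γ r hπ] at h1
    rw [bOpS_eq_sum P γ r hmix]
    simp only [mixPol, add_mul, Finset.sum_add_distrib, mul_assoc, ← Finset.mul_sum, h1]
    simp [detPol, bOp]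
  have hQval : ∀ (x : S → ℝ) s, bOpS P γ r (mixPol α π (detPol π')) x s
      = r s + γ * ∑ s', Q s s' * x s' := fun x s => rfl
  have hQU : ∀ s, e s + γ * ∑ s', Q s s' * U s' ≤ U s := by
    intro s
    have h : bOpS P γ e (mixPol α π (detPol π')) U s ≤ U s := by
      rw [bOpS_eq_sum P γ e hmix]
      calc _ ≤ ∑ a, mixPol α π (detPol π') s a * U s := Finset.sum_le_sum fun a _ =>
            mul_le_mul_of_nonneg_left (hU s a) (hmix.1 s a)
        _ = U s := by rw [← Finset.sum_mul, hmix.2 s, one_mul]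
    exact h
  have hQ0 := polMatS_nonneg hP0 hmix
  have hd := nonneg_of_discounted_le hγ0 hγ1 Q hQ0 (polMatS_sum hP1 hmix)
    (fun s => w s - v s - α * (M s - v s) + α * U s) (fun s => by
      have e1 := congrFun hw s
      rw [hQval] at e1
      have e2 := hTmix s
      rw [hQval] at e2
      have e3 := heM s
      have e4 := hQU s
      have e5 : 0 ≤ ∑ s', Q s s' * (M s' - v s') :=
        Finset.sum_nonneg fun s' _ => mul_nonneg (hQ0 s s') (by linarith [hMv s'])
      have e6 : ∑ s', Q s s' * (w s' - v s' - α * (M s' - v s') + α * U s')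
          = ∑ s', Q s s' * w s' - ∑ s', Q s s' * v s'
            - α * ∑ s', Q s s' * (M s' - v s') + α * ∑ s', Q s s' * U s' := by
        simp only [Finset.mul_sum, ← Finset.sum_sub_distrib, ← Finset.sum_add_distrib]
        exact Finset.sum_congr rfl fun s' _ => by ring
      rw [e6]
      have e7 := mul_le_mul_of_nonneg_left e4 hα0.le
      have e8 : 0 ≤ α * γ * ∑ s', Q s s' * (M s' - v s') := by positivity
      rw [e3] at e7
      linarith) s
  have hstar := congrFun hfix s
  have hMs := hMle πstar s
  simp only [bOp] at hstar hMs
  have hdiff : ∑ s', P s (πstar s) s' * (vstar s' - v s')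
      = ∑ s', P s (πstar s) s' * vstar s' - ∑ s', P s (πstar s) s' * v s' := by
    simp only [mul_sub, Finset.sum_sub_distrib]
  rw [hdiff]
  have := mul_le_mul_of_nonneg_left hMs hα0.le
  have h3 := congrArg (fun x => α * x) hstar
  linarith

/-- CPI(α): for a CPI sequence with constant step `α ∈ (0,1]`,
`d_{π_{i−1},ν} e_i ≤ ε` for all `i ≥ 1`, `ε ∈ (0, 2Vmax]` and
`C^{(1,0)} = (1−γ)Σ_l γ^l c(l) < ∞`: if `k = ⌈log(2Vmax/ε)/(α(1−γ))⌉` then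
`μ(v_{π*} − v_{π_k}) ≤ (αk C^{(1,0)}/(1−γ)^2 + 1) ε
≤ (C^{(1,0)}(log(2Vmax/ε)/(1−γ) + 1)/(1−γ)^2 + 1) ε`. -/
theorem stmt14
    {S A : Type*} [Fintype S] [Fintype A] [DecidableEq S] [DecidableEq A]
    [Nonempty S] [Nonempty A]
    (P : S → A → S → ℝ) (hP0 : ∀ s a s', 0 ≤ P s a s')
    (hP1 : ∀ s a, ∑ s' : S, P s a s' = 1)
    (γ : ℝ) (hγ0 : 0 < γ) (hγ1 : γ < 1)
    (Rmax Vmax : ℝ) (r : S → ℝ) (hr : ∀ s, |r s| ≤ Rmax)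
    (hVmax : Vmax = Rmax / (1 - γ))
    (πstar : S → A) (vstar : S → ℝ)
    (hfix : bOp P γ r πstar vstar = vstar)
    (hopt : ∀ (π : S → A) (v : S → ℝ), bOp P γ r π v = v → ∀ s, v s ≤ vstar s)
    (μ ν : S → ℝ) (hμ0 : ∀ s, 0 ≤ μ s) (hμ1 : ∑ s : S, μ s = 1)
    (hν0 : ∀ s, 0 ≤ ν s) (hν1 : ∑ s : S, ν s = 1)
    (c : ℕ → ℝ) (hc0 : ∀ i, 0 ≤ c i)
    (hc : ∀ (i : ℕ) (πs : ℕ → S → A) (s : S),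
      Matrix.vecMul μ (((List.range i).map fun t => polMat P (πs t)).prod) s ≤ c i * ν s)
    (hsum : Summable fun l : ℕ => γ ^ l * c l)
    (π0 : S → A → ℝ) (hπ0 : isStoch π0)
    (α : ℝ) (hα0 : 0 < α) (hα1 : α ≤ 1)
    (π'f : ℕ → S → A)
    (vS : ℕ → S → ℝ)
    (hvS : ∀ i : ℕ, bOpS P γ r (cpiSeq π0 (fun _ => α) π'f i) (vS i) = vS i)
    (ε : ℝ) (hε0 : 0 < ε) (hε1 : ε ≤ 2 * Vmax)
    (herr : ∀ i, 1 ≤ i →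
      (∑ s : S, ((1 - γ) • Matrix.vecMul ν
          (1 - γ • polMatS P (cpiSeq π0 (fun _ => α) π'f (i - 1)))⁻¹) s
        * errOf P γ r (vS (i - 1)) (π'f i) s) ≤ ε)
    (k : ℕ) (hk : k = ⌈Real.log (2 * Vmax / ε) / (α * (1 - γ))⌉₊) :
    (∑ s : S, μ s * (vstar s - vS k s)) ≤
        (α * k * ((1 - γ) * ∑' l : ℕ, γ ^ l * c l) / (1 - γ) ^ 2 + 1) * ε
    ∧ (α * k * ((1 - γ) * ∑' l : ℕ, γ ^ l * c l) / (1 - γ) ^ 2 + 1) * ε ≤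
        (((1 - γ) * ∑' l : ℕ, γ ^ l * c l)
            * (Real.log (2 * Vmax / ε) / (1 - γ) + 1) / (1 - γ) ^ 2 + 1) * ε := by
  have hγ' : 0 < 1 - γ := by linarith
  set L := Real.log (2 * Vmax / ε) with hL
  set C := ∑' l : ℕ, γ ^ l * c l with hC
  have hC0 : 0 ≤ C := tsum_nonneg fun l => mul_nonneg (pow_nonneg hγ0.le _) (hc0 l)
  have hL0 : 0 ≤ L := Real.log_nonneg ((one_le_div hε0).2 hε1)
  have hV : (1 - γ) * Vmax = Rmax := by rw [hVmax]; field_simp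
  constructor
  · have hst := isStoch_cpiSeq_s14 hπ0 hα0 hα1 π'f
    have herr0 : ∀ i s, 0 ≤ errOf P γ r (vS i) (π'f (i + 1)) s := fun i s =>
      sub_nonneg.2 (Finset.le_sup' (fun σ : S → A => bOp P γ r σ (vS i) s)
        (Finset.mem_univ (π'f (i + 1))))
    have hνe : ∀ i, (1 - γ) * ∑ s, ν s * errOf P γ r (vS i) (π'f (i + 1)) s ≤ ε := by
      intro i
      refine (sum_mul_le_occupancy hγ0 hγ1 _ (polMatS_nonneg hP0 (hst i))
        (polMatS_sum hP1 (hst i)) ν _ hν0 (herr0 i)).trans ?_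
      exact herr (i + 1) (by omega)
    have hinit : ∀ s, vstar s - vS 0 s ≤ 2 * Vmax := by
      intro s
      have h1 := nonneg_of_discounted_le hγ0 hγ1 (fun s s' => P s (πstar s) s')
        (fun s s' => hP0 _ _ _) (fun s => hP1 _ _) (fun s => Vmax - vstar s) (fun s => by
          have h := congrFun hfix s
          simp only [bOp] at h
          simp only [mul_sub, Finset.sum_sub_distrib, ← Finset.sum_mul, hP1, one_mul]
          linarith [(abs_le.1 (hr s)).2]) s
      have h2 := nonneg_of_discounted_le hγ0 hγ1 (polMatS P π0)
        (polMatS_nonneg hP0 hπ0) (polMatS_sum hP1 hπ0) (fun s => Vmax + vS 0 s) (fun s => by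
          have h : r s + γ * ∑ s', polMatS P π0 s s' * vS 0 s' = vS 0 s :=
            congrFun (hvS 0) s
          simp only [mul_add, Finset.sum_add_distrib, ← Finset.sum_mul,
            polMatS_sum hP1 hπ0, one_mul]
          linarith [(abs_le.1 (hr s)).1]) s
      linarith
    have hβ0 : 0 ≤ 1 - α * (1 - γ) := by nlinarith
    have hdecay : (1 - α * (1 - γ)) ^ k * (2 * Vmax) ≤ ε := by
      have h1 : (1 - α * (1 - γ)) ^ k ≤ Real.exp (-L) := by
        calc (1 - α * (1 - γ)) ^ k ≤ (Real.exp (-(α * (1 - γ)))) ^ k :=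
              pow_le_pow_left₀ hβ0 (Real.one_sub_le_exp_neg _) k
          _ = Real.exp (-(k * (α * (1 - γ)))) := by rw [← Real.exp_nat_mul]; ring_nf
          _ ≤ Real.exp (-L) := by
            apply Real.exp_le_exp.2
            have := Nat.le_ceil (L / (α * (1 - γ)))
            rw [← hk, div_le_iff₀ (by positivity)] at this
            linarith
      have h2 : 0 < Vmax := by linarith
      calc _ ≤ Real.exp (-L) * (2 * Vmax) := mul_le_mul_of_nonneg_right h1 (by linarith)
        _ = ε := by
          rw [Real.exp_neg, hL, Real.exp_log (by positivity)]
          field_simp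
    refine le_of_forall_pos_le_add fun η hη => ?_
    have hδ : 0 < η / (α * k + 1) := by positivity
    set δ := η / (α * k + 1) with hδdef
    choose U hU hμU using fun i => exists_superharmonic_le P hP0 hP1 hγ0 hγ1 μ ν hμ1 hν0 c
      hc0 hc hsum (errOf P γ r (vS i) (π'f (i + 1))) (herr0 i) hδ
    have hmain : ∀ j s, vstar s - vS j s ≤ (1 - α * (1 - γ)) ^ j * (2 * Vmax)
        + α * ∑ i ∈ Finset.range j, U i s := by
      intro j
      induction j with
      | zero => intro s; simpa using hinit s
      | succ j ih =>
        intro s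
        have h1 := cpi_step P hP0 hP1 hγ0 hγ1 r πstar vstar hfix hα0 _ (π'f (j + 1))
          (hst j) (hst (j + 1)) (vS j) (vS (j + 1)) (U j) (hvS j) (hvS (j + 1)) (hU j) s
        refine h1.trans ?_
        set B := (1 - α * (1 - γ)) ^ j * (2 * Vmax) with hB
        have h2 : ∑ s', P s (πstar s) s' * (vstar s' - vS j s')
            ≤ B + α * ∑ i ∈ Finset.range j, ∑ s', P s (πstar s) s' * U i s' := by
          calc _ ≤ ∑ s', P s (πstar s) s' * (B + α * ∑ i ∈ Finset.range j, U i s') :=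
                Finset.sum_le_sum fun s' _ => mul_le_mul_of_nonneg_left (ih s') (hP0 _ _ _)
            _ = _ := by
              simp only [mul_add, Finset.sum_add_distrib, ← Finset.sum_mul, hP1, one_mul]
              congr 1
              rw [Finset.sum_comm, Finset.mul_sum]
              refine Finset.sum_congr rfl fun s' _ => ?_
              rw [← Finset.mul_sum]
              ring
        have h3 : γ * ∑ i ∈ Finset.range j, ∑ s', P s (πstar s) s' * U i s'
            ≤ ∑ i ∈ Finset.range j, U i s := by
          rw [Finset.mul_sum]
          exact Finset.sum_le_sum fun i _ => by
            linarith [hU i s (πstar s), herr0 i s]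
        have h4 := mul_le_mul_of_nonneg_left (ih s) (by linarith : 0 ≤ 1 - α)
        have h5 := mul_le_mul_of_nonneg_left h2 (mul_nonneg hα0.le hγ0.le)
        have h6 := mul_le_mul_of_nonneg_left h3 (mul_nonneg hα0.le hα0.le)
        rw [Finset.sum_range_succ, pow_succ', mul_assoc, ← hB]
        linarith
    have hUb : ∀ i, ∑ s, μ s * U i s ≤ C * ε / (1 - γ) + δ := by
      intro i
      refine (hμU i).trans (add_le_add ?_ le_rfl)
      rw [mul_div_assoc]
      refine mul_le_mul_of_nonneg_left ?_ hC0
      rw [le_div_iff₀ hγ']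
      linarith [hνe i]
    calc ∑ s, μ s * (vstar s - vS k s)
        ≤ ∑ s, μ s * ((1 - α * (1 - γ)) ^ k * (2 * Vmax)
          + α * ∑ i ∈ Finset.range k, U i s) :=
          Finset.sum_le_sum fun s _ => mul_le_mul_of_nonneg_left (hmain k s) (hμ0 s)
      _ = (1 - α * (1 - γ)) ^ k * (2 * Vmax)
          + α * ∑ i ∈ Finset.range k, ∑ s, μ s * U i s := by
        simp only [mul_add, Finset.sum_add_distrib, ← Finset.sum_mul, hμ1, one_mul]
        congr 1
        rw [Finset.sum_comm, Finset.mul_sum]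
        refine Finset.sum_congr rfl fun s _ => ?_
        rw [← Finset.mul_sum]
        ring
      _ ≤ ε + α * ∑ i ∈ Finset.range k, (C * ε / (1 - γ) + δ) :=
        add_le_add hdecay (mul_le_mul_of_nonneg_left
          (Finset.sum_le_sum fun i _ => hUb i) hα0.le)
      _ = (α * k * ((1 - γ) * C) / (1 - γ) ^ 2 + 1) * ε + α * k * δ := by
        rw [Finset.sum_const, Finset.card_range, nsmul_eq_mul]
        field_simp
        ring
      _ ≤ _ := by
        have h : (α * k + 1) * δ = η := by
          rw [hδdef]
          field_simp
        linarith
  · refine mul_le_mul_of_nonneg_right (add_le_add ?_ le_rfl) hε0.le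
    refine div_le_div_of_nonneg_right ?_ (by positivity)
    rw [mul_comm]
    refine mul_le_mul_of_nonneg_left ?_ (mul_nonneg hγ'.le hC0)
    have h1 : (k : ℝ) < L / (α * (1 - γ)) + 1 := by
      rw [hk]
      exact Nat.ceil_lt_add_one (by positivity)
    have h2 : α * (L / (α * (1 - γ)) + 1) = L / (1 - γ) + α := by
      field_simp
    have h3 := mul_le_mul_of_nonneg_left h1.le hα0.le
    linarith
end
end
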